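/- Let A be a real n×n matrix, B a real n×m matrix, M a symmetric real n×n matrix, R an invertible symmetric real m×m matrix, and P a symmetric real n×n matrix satisfying the algebraic Riccati equation Aᵀ P + P A − P B R⁻¹ Bᵀ P + M = 0. Suppose x : ℝ → ℝⁿ is continuously differentiable, u : ℝ → ℝᵐ is continuous, x'(τ) = A x(τ) + B u(τ) for all τ, and the function W(τ) = (u(τ) + R⁻¹ Bᵀ P x(τ))ᵀ R (u(τ) + R⁻¹ Bᵀ P x(τ)) is integrable on [t, ∞) for the relevant t. Then for every t ∈ ℝ and every T ≥ 0, the function Q defined by Q(s) = x(s)ᵀ P x(s) + ∫_s^∞ W(τ) dτ satisfies Q(t) = Q(t+T) + ∫_t^{t+T} ( x(τ)ᵀ M x(τ) + u(τ)ᵀ R u(τ) ) dτ. -/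

import Mathlib

open Matrix MeasureTheory

/-- A symmetric matrix moves across the dot product. -/
theorem dotProduct_mulVec_of_isSymm {k : ℕ} {S : Matrix (Fin k) (Fin k) ℝ} (hS : S.IsSymm)
    (a b : Fin k → ℝ) : a ⬝ᵥ S *ᵥ b = S *ᵥ a ⬝ᵥ b := by
  rw [dotProduct_mulVec, ← mulVec_transpose, hS]

/-- Completion of squares: under the Riccati equation, the derivative of `xᵀ P x` along
`x' = A x + B u` is `‖u + R⁻¹ Bᵀ P x‖²_R` minus the running cost. -/
theorem riccati_completion_of_squares {n m : ℕ}
    {A : Matrix (Fin n) (Fin n) ℝ} {B : Matrix (Fin n) (Fin m) ℝ}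
    {M : Matrix (Fin n) (Fin n) ℝ} {R : Matrix (Fin m) (Fin m) ℝ} (hR : R.IsSymm)
    (hRinv : IsUnit R.det) {P : Matrix (Fin n) (Fin n) ℝ} (hP : P.IsSymm)
    (hARE : Aᵀ * P + P * A - P * B * R⁻¹ * Bᵀ * P + M = 0)
    (x : Fin n → ℝ) (u : Fin m → ℝ) :
    (A *ᵥ x + B *ᵥ u) ⬝ᵥ P *ᵥ x + x ⬝ᵥ P *ᵥ (A *ᵥ x + B *ᵥ u) =
      (u + R⁻¹ *ᵥ (Bᵀ *ᵥ (P *ᵥ x))) ⬝ᵥ R *ᵥ (u + R⁻¹ *ᵥ (Bᵀ *ᵥ (P *ᵥ x))) -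
        (x ⬝ᵥ M *ᵥ x + u ⬝ᵥ R *ᵥ u) := by
  have hB (w : Fin m → ℝ) : P *ᵥ x ⬝ᵥ B *ᵥ w = Bᵀ *ᵥ (P *ᵥ x) ⬝ᵥ w := by
    rw [dotProduct_mulVec, ← mulVec_transpose]
  have hA : x ⬝ᵥ Aᵀ *ᵥ (P *ᵥ x) = A *ᵥ x ⬝ᵥ P *ᵥ x := by
    rw [dotProduct_mulVec, vecMul_transpose]
  have hRR (y : Fin m → ℝ) : R *ᵥ (R⁻¹ *ᵥ y) = y := by
    rw [mulVec_mulVec, mul_nonsing_inv _ hRinv, one_mulVec]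
  have h : x ⬝ᵥ (Aᵀ * P + P * A - P * B * R⁻¹ * Bᵀ * P + M) *ᵥ x = 0 := by
    rw [hARE, zero_mulVec, dotProduct_zero]
  simp only [add_mulVec, sub_mulVec, ← mulVec_mulVec, dotProduct_add, dotProduct_sub, hA,
    dotProduct_mulVec_of_isSymm hP x, hB] at h
  simp only [mulVec_add, dotProduct_add, add_dotProduct, hRR,
    dotProduct_mulVec_of_isSymm hP x, hB, dotProduct_comm (B *ᵥ u),
    dotProduct_mulVec_of_isSymm hR (R⁻¹ *ᵥ _)]
  rw [dotProduct_comm u (Bᵀ *ᵥ _), dotProduct_comm (R⁻¹ *ᵥ _) (Bᵀ *ᵥ _)]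
  linarith

/-- Product rule for the dot product with a constant matrix in between. -/
theorem HasDerivAt.dotProduct_mulVec_self {k : ℕ} (S : Matrix (Fin k) (Fin k) ℝ)
    {x : ℝ → Fin k → ℝ} {x' : Fin k → ℝ} {t : ℝ} (hx : HasDerivAt x x' t) :
    HasDerivAt (fun s => x s ⬝ᵥ S *ᵥ x s) (x' ⬝ᵥ S *ᵥ x t + x t ⬝ᵥ S *ᵥ x') t := by
  have hi := hasDerivAt_pi.1 hx
  simp only [dotProduct, mulVec, ← Finset.sum_add_distrib]
  exact HasDerivAt.fun_sum fun i _ =>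
    (hi i).mul (HasDerivAt.fun_sum fun j _ => (hi j).const_mul (S i j))

/-- Paper's Lemma 1 (semi-group property of the Q-function): with
`W(τ) = ‖u(τ) + R⁻¹ Bᵀ P x(τ)‖²_R` integrable on `[t, ∞)` and
`Q(s) = x(s)ᵀ P x(s) + ∫_s^∞ W`, one has
`Q(t) = Q(t+T) + ∫_t^{t+T} (xᵀ M x + uᵀ R u)` for all `t` and `T ≥ 0`. -/
theorem q_function_semigroup
    (n m : ℕ)
    (A : Matrix (Fin n) (Fin n) ℝ) (B : Matrix (Fin n) (Fin m) ℝ)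
    (M : Matrix (Fin n) (Fin n) ℝ) (hM : M.IsSymm)
    (R : Matrix (Fin m) (Fin m) ℝ) (hR : R.IsSymm) (hRinv : IsUnit R.det)
    (P : Matrix (Fin n) (Fin n) ℝ) (hP : P.IsSymm)
    (hARE : Aᵀ * P + P * A - P * B * R⁻¹ * Bᵀ * P + M = 0)
    (x : ℝ → Fin n → ℝ) (u : ℝ → Fin m → ℝ)
    (hu : Continuous u)
    (hx : ∀ τ : ℝ, HasDerivAt x (A.mulVec (x τ) + B.mulVec (u τ)) τ)
    (W : ℝ → ℝ)
    (hW : W = fun τ =>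
      (u τ + R⁻¹.mulVec (Bᵀ.mulVec (P.mulVec (x τ)))) ⬝ᵥ
        R.mulVec (u τ + R⁻¹.mulVec (Bᵀ.mulVec (P.mulVec (x τ)))))
    (hWint : ∀ t : ℝ, IntegrableOn W (Set.Ici t))
    (Q : ℝ → ℝ)
    (hQ : Q = fun s => x s ⬝ᵥ P.mulVec (x s) + ∫ τ in Set.Ioi s, W τ) :
    ∀ (t T : ℝ), 0 ≤ T →
      Q t = Q (t + T)
        + ∫ τ in t..(t + T), (x τ ⬝ᵥ M.mulVec (x τ) + u τ ⬝ᵥ R.mulVec (u τ)) := by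
  intro t T hT
  have hxc : Continuous x := continuous_iff_continuousAt.2 fun τ => (hx τ).continuousAt
  have hWc : Continuous W := by subst hW; fun_prop
  have hcost : Continuous fun τ => x τ ⬝ᵥ M.mulVec (x τ) + u τ ⬝ᵥ R.mulVec (u τ) := by fun_prop
  have hderiv (τ : ℝ) : HasDerivAt (fun s => x s ⬝ᵥ P.mulVec (x s))
      (W τ - (x τ ⬝ᵥ M.mulVec (x τ) + u τ ⬝ᵥ R.mulVec (u τ))) τ := by
    have h := (hx τ).dotProduct_mulVec_self P
    rwa [riccati_completion_of_squares hR hRinv hP hARE, ← congrFun hW τ] at h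
  have hFTC := intervalIntegral.integral_eq_sub_of_hasDerivAt (a := t) (b := t + T)
    (fun τ _ => hderiv τ) ((hWc.sub hcost).intervalIntegrable _ _)
  rw [intervalIntegral.integral_sub (hWc.intervalIntegrable _ _)
    (hcost.intervalIntegrable _ _)] at hFTC
  have hIoi (s : ℝ) : IntegrableOn W (Set.Ioi s) := (hWint s).mono_set Set.Ioi_subset_Ici_self
  have htail := intervalIntegral.integral_Ioi_sub_Ioi (hIoi t) (le_add_of_nonneg_right hT)
  subst hQ
  linarith
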